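/- arXiv:2111.02562 — 2 statements merged into one kernel-verified Lean document; each statement's English description precedes it below -/
import Mathlib

section
/- Let ℓ be a prime. The number of matrices M ∈ GL₂(𝔽_ℓ) that are special, i.e., satisfy det M = 1 and have 1 as an eigenvalue, is exactly ℓ². -/
open Matrix
open scoped MatrixGroups

/-- A matrix in `GL₂` is *special* if it has determinant 1 and fixes a nonzero vector. -/
def Special {R : Type*} [CommRing R] (M : GL (Fin 2) R) : Prop :=
  (M : Matrix (Fin 2) (Fin 2) R).det = 1 ∧
    ∃ v : Fin 2 → R, v ≠ 0 ∧ (M : Matrix (Fin 2) (Fin 2) R).mulVec v = v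

theorem special_iff_det_trace {K : Type*} [Field K] (M : GL (Fin 2) K) :
    Special M ↔ M.val.det = 1 ∧ M.val.trace = 2 := by
  refine and_congr_right fun hdet => ?_
  have hfix : (∃ v : Fin 2 → K, v ≠ 0 ∧ M.val *ᵥ v = v) ↔ (M.val - 1).det = 0 := by
    rw [← Matrix.exists_mulVec_eq_zero_iff]
    simp only [Matrix.sub_mulVec, Matrix.one_mulVec, sub_eq_zero]
  rw [hfix]
  simp only [Matrix.det_fin_two, Matrix.trace_fin_two, Matrix.sub_apply, Matrix.one_apply_eq,
    Matrix.one_apply_ne zero_ne_one, Matrix.one_apply_ne one_ne_zero] at hdet ⊢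
  constructor <;> intro h <;> linear_combination hdet - h

open Classical in
/-- Special matrices are parametrized by their upper right entry `y` and one further entry:
the upper left one if `y ≠ 0`, and the lower left one if `y = 0`. -/
noncomputable def specialEquivProd (K : Type*) [Field K] :
    {M : GL (Fin 2) K // Special M} ≃ K × K where
  toFun M := (M.1 0 1, if M.1 0 1 = 0 then M.1 1 0 else M.1 0 0 - 1)
  invFun p :=
    have hdet : (if p.1 = 0 then !![1, 0; p.2, 1]
        else !![1 + p.2, p.1; -p.2 ^ 2 / p.1, 1 - p.2] : Matrix (Fin 2) (Fin 2) K).det = 1 := by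
      split_ifs with h
      · simp
      · rw [Matrix.det_fin_two_of]
        field_simp
        ring
    ⟨Matrix.GeneralLinearGroup.mkOfDetNeZero _ (hdet.trans_ne one_ne_zero),
      (special_iff_det_trace _).2 ⟨hdet, by
        change Matrix.trace (ite _ _ _) = 2
        split_ifs <;> rw [Matrix.trace_fin_two_of] <;> ring⟩⟩
  left_inv := by
    rintro ⟨M, hM⟩
    obtain ⟨hdet, htrace⟩ := (special_iff_det_trace M).1 hM
    rw [Matrix.det_fin_two] at hdet
    rw [Matrix.trace_fin_two] at htrace
    refine Subtype.ext (Units.ext ?_)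
    change ite _ _ _ = M.val
    have h11 : M.val 1 1 = 2 - M.val 0 0 := by linear_combination htrace
    rw [h11] at hdet
    by_cases h : M.val 0 1 = 0
    · have h00 : M.val 0 0 = 1 := by
        have : (M.val 0 0 - 1) ^ 2 = 0 := by
          linear_combination -hdet - M.val 1 0 * h
        exact sub_eq_zero.1 (pow_eq_zero_iff two_ne_zero |>.1 this)
      ext i j
      fin_cases i <;> fin_cases j <;> simp [h, h00, h11]
      norm_num
    · have h10 : -(M.val 0 0 - 1) ^ 2 / M.val 0 1 = M.val 1 0 := by
        rw [div_eq_iff h]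
        linear_combination hdet
      ext i j
      fin_cases i <;> fin_cases j <;> simp [h, h10, h11]
      ring
  right_inv := by
    rintro ⟨y, t⟩
    by_cases h : y = 0 <;> simp [h, Matrix.GeneralLinearGroup.mkOfDetNeZero]

/-- Let `ℓ` be a prime. There are exactly `ℓ²` matrices in `GL₂(𝔽_ℓ)` with
determinant 1 having 1 as an eigenvalue. -/
theorem card_special {ℓ : ℕ} [Fact ℓ.Prime] :
    Nat.card {M : GL (Fin 2) (ZMod ℓ) // Special M} = ℓ ^ 2 := by
  rw [Nat.card_congr (specialEquivProd (ZMod ℓ)), Nat.card_prod, Nat.card_zmod, sq]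
end

section
/- Let ℓ be an odd prime and let χ : 𝔽_ℓ^× → {±1} be a nontrivial group homomorphism (i.e., there exists a unit u with χ(u) = −1). Then the sum of χ(det M), taken over all matrices M ∈ GL₂(𝔽_ℓ) that are not special, equals −ℓ². -/
open Matrix
open scoped MatrixGroups

theorem special_iff_det_eq_one_and_trace_eq_two {F : Type*} [Field F] (M : GL (Fin 2) F) :
    Special M ↔ (M : Matrix (Fin 2) (Fin 2) F).det = 1 ∧
      (M : Matrix (Fin 2) (Fin 2) F).trace = 2 := by
  refine and_congr_right fun hdet => ?_
  have hfix : (∃ v : Fin 2 → F, v ≠ 0 ∧ (M : Matrix (Fin 2) (Fin 2) F).mulVec v = v) ↔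
      ((M : Matrix (Fin 2) (Fin 2) F) - 1).det = 0 := by
    rw [← Matrix.exists_mulVec_eq_zero_iff]
    simp only [Matrix.sub_mulVec, Matrix.one_mulVec, sub_eq_zero]
  rw [hfix]
  rw [Matrix.det_fin_two] at hdet
  simp only [Matrix.det_fin_two, Matrix.trace_fin_two, Matrix.sub_apply, Matrix.one_apply_eq,
    ne_eq, zero_ne_one, one_ne_zero, not_false_eq_true, Matrix.one_apply_ne]
  constructor <;> intro h <;> linear_combination hdet - h

open Classical in
/-- A parametrization of the special matrices: `b` is the upper right entry, and `t` determines
the diagonal if `b ≠ 0` and is the lower left entry otherwise. -/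
noncomputable def specialOfPair {F : Type*} [Field F] (p : F × F) : GL (Fin 2) F :=
  Matrix.GeneralLinearGroup.mkOfDetNeZero
    (if p.1 = 0 then !![1, 0; p.2, 1] else !![1 + p.2, p.1; -p.2 ^ 2 / p.1, 1 - p.2])
    (by
      split_ifs with hb
      · simp [Matrix.det_fin_two]
      · have h : (1 + p.2) * (1 - p.2) - p.1 * (-p.2 ^ 2 / p.1) = 1 := by field_simp; ring
        simp [Matrix.det_fin_two, h])

open Classical in
theorem coe_specialOfPair {F : Type*} [Field F] (b t : F) :
    (specialOfPair (b, t) : Matrix (Fin 2) (Fin 2) F) =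
      if b = 0 then !![1, 0; t, 1] else !![1 + t, b; -t ^ 2 / b, 1 - t] := rfl

theorem special_specialOfPair {F : Type*} [Field F] (p : F × F) : Special (specialOfPair p) := by
  obtain ⟨b, t⟩ := p
  rw [special_iff_det_eq_one_and_trace_eq_two, coe_specialOfPair]
  split_ifs with hb
  · norm_num [Matrix.det_fin_two, Matrix.trace_fin_two]
  · simp only [Matrix.det_fin_two_of, Matrix.trace_fin_two_of]
    constructor
    · field_simp
      ring
    · ring

theorem specialOfPair_injective {F : Type*} [Field F] :
    Function.Injective (specialOfPair (F := F)) := by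
  rintro ⟨b, t⟩ ⟨b', t'⟩ h
  have hmat := congrArg (Units.val) h
  rw [coe_specialOfPair, coe_specialOfPair] at hmat
  have h00 := congrFun (congrFun hmat 0) 0
  have h01 := congrFun (congrFun hmat 0) 1
  have h10 := congrFun (congrFun hmat 1) 0
  split_ifs at h00 h01 h10 <;> simp_all

theorem exists_specialOfPair_eq {F : Type*} [Field F] {M : GL (Fin 2) F} (hM : Special M) :
    ∃ p, specialOfPair p = M := by
  obtain ⟨hdet, htr⟩ := (special_iff_det_eq_one_and_trace_eq_two M).1 hM
  rw [Matrix.det_fin_two] at hdet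
  rw [Matrix.trace_fin_two] at htr
  by_cases hb : M 0 1 = 0
  · have h00 : M 0 0 = 1 := by
      have h : (M 0 0 - 1) ^ 2 = 0 := by
        linear_combination M 0 0 * htr - hdet - M 1 0 * hb
      exact sub_eq_zero.1 (pow_eq_zero_iff two_ne_zero |>.1 h)
    have h11 : M 1 1 = 1 := by linear_combination htr - h00
    refine ⟨(0, M 1 0), Units.ext ?_⟩
    rw [coe_specialOfPair, if_pos rfl]
    ext i j
    fin_cases i <;> fin_cases j <;> simp [h00, h11, hb]
  · have h11 : 1 - (M 0 0 - 1) = M 1 1 := by linear_combination -htr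
    have h10 : -(M 0 0 - 1) ^ 2 / M 0 1 = M 1 0 := by
      rw [div_eq_iff hb]
      linear_combination hdet - M 0 0 * htr
    refine ⟨(M 0 1, M 0 0 - 1), Units.ext ?_⟩
    rw [coe_specialOfPair, if_neg hb]
    ext i j
    fin_cases i <;> fin_cases j <;> simp [h10, h11]

open Classical in
theorem card_filter_special {F : Type*} [Field F] [Fintype F] [Fintype (GL (Fin 2) F)] :
    (Finset.univ.filter (fun M : GL (Fin 2) F => Special M)).card = Fintype.card F ^ 2 := by
  have himage : Finset.univ.filter (fun M : GL (Fin 2) F => Special M) =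
      Finset.univ.image (specialOfPair (F := F)) := by
    ext M
    simp only [Finset.mem_filter, Finset.mem_univ, true_and, Finset.mem_image]
    refine ⟨exists_specialOfPair_eq, ?_⟩
    rintro ⟨p, rfl⟩
    exact special_specialOfPair p
  rw [himage, Finset.card_image_of_injective _ specialOfPair_injective, Finset.card_univ,
    Fintype.card_prod, sq]

/-- A sign character of a finite group taking the value `-1` sums to zero. -/
theorem sum_eq_zero_of_exists_eq_neg_one {G : Type*} [Group G] [Fintype G] (ψ : G →* ℤˣ)
    (hψ : ∃ g, ψ g = -1) : ∑ g, (ψ g : ℤ) = 0 := by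
  obtain ⟨g₀, hg₀⟩ := hψ
  have h : ∑ g, (ψ (g₀ * g) : ℤ) = ∑ g, (ψ g : ℤ) :=
    Equiv.sum_comp (Equiv.mulLeft g₀) fun g => (ψ g : ℤ)
  simp only [map_mul, hg₀, neg_mul, one_mul, Units.val_neg, Finset.sum_neg_distrib] at h
  linarith

theorem det_surjective_GL_two {F : Type*} [Field F] :
    Function.Surjective (Matrix.GeneralLinearGroup.det : GL (Fin 2) F →* Fˣ) := fun u =>
  ⟨Matrix.GeneralLinearGroup.mkOfDetNeZero !![(u : F), 0; 0, 1] (by simp [Matrix.det_fin_two]),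
    Units.ext (by
      change Matrix.det !![(u : F), 0; 0, 1] = u
      simp [Matrix.det_fin_two])⟩

open Classical in
/-- Let `ℓ` be an odd prime and `χ : 𝔽_ℓˣ → {±1}` a nontrivial homomorphism.
The sum of `χ(det M)` over all non-special `M ∈ GL₂(𝔽_ℓ)` equals `−ℓ²`. -/
theorem sum_chi_det_not_special {ℓ : ℕ} [Fact ℓ.Prime] (hℓ : ℓ ≠ 2)
    (χ : (ZMod ℓ)ˣ →* ℤˣ) (hχ : ∃ u : (ZMod ℓ)ˣ, χ u = -1) :
    ∑ M ∈ Finset.univ.filter (fun M : GL (Fin 2) (ZMod ℓ) => ¬ Special M),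
      ((χ (Matrix.GeneralLinearGroup.det M) : ℤˣ) : ℤ) = -(ℓ : ℤ) ^ 2 := by
  obtain ⟨u, hu⟩ := hχ
  obtain ⟨M₀, rfl⟩ := det_surjective_GL_two u
  have hall := sum_eq_zero_of_exists_eq_neg_one (χ.comp Matrix.GeneralLinearGroup.det) ⟨M₀, hu⟩
  rw [← Finset.sum_filter_add_sum_filter_not _ (fun M : GL (Fin 2) (ZMod ℓ) => Special M)] at hall
  have hspecial : ∑ M ∈ Finset.univ.filter (fun M : GL (Fin 2) (ZMod ℓ) => Special M),
      (((χ.comp Matrix.GeneralLinearGroup.det) M : ℤˣ) : ℤ) = (ℓ : ℤ) ^ 2 := by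
    rw [Finset.sum_congr rfl (g := fun _ => (1 : ℤ)) fun M hM => ?_]
    · rw [Finset.sum_const, nsmul_one, card_filter_special, ZMod.card, Nat.cast_pow]
    · have hdet : Matrix.GeneralLinearGroup.det M = 1 :=
        Units.ext (Finset.mem_filter.1 hM).2.1
      simp [hdet]
  rw [hspecial] at hall
  exact eq_neg_of_add_eq_zero_right hall
end
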